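/- Quantitative polynomial expansivity (Theorem C): Let P = (P₁, …, P_d) : ℤ^r → ℤ^d be an integer polynomial map with zero constant term whose components P₁, …, P_d are linearly independent over ℚ. Then for every real δ > 0 and every real ε > 0 there exists a positive integer k₀ = k₀(P, δ, ε) such that the following holds. For every ergodic measure-preserving ℤ^d-action T on a probability space (X, μ) and every measurable set A ⊆ X with μ(A) ≥ δ, there exist a positive integer k ≤ k₀ and a T^k-ergodic component ν of μ with ν(A) ≥ μ(A) satisfying ν(⋃_{n∈ℤ^r} (T^{P(n)})⁻¹ A) > 1 − ε. -/

import Mathlib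

open MeasureTheory Filter
open scoped symmDiff

/-- A measure-preserving `ℤ^d`-action on `(X, μ)`: a family of measurable maps
`(T v)_{v ∈ ℤ^d}` with `T 0 = id`, `T (v+w) = T v ∘ T w`, each preserving `μ`. -/
def IsMPAction {X : Type} [MeasurableSpace X] (d : ℕ)
    (T : (Fin d → ℤ) → X → X) (μ : Measure X) : Prop :=
  T 0 = id ∧ (∀ v w, T (v + w) = T v ∘ T w) ∧ ∀ v, MeasurePreserving (T v) μ μ

/-- The action is ergodic: every measurable set invariant (up to null sets) under
all the maps `T v` has measure `0` or `1`. -/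
def IsErgodicAction {X : Type} [MeasurableSpace X] (d : ℕ)
    (T : (Fin d → ℤ) → X → X) (μ : Measure X) : Prop :=
  IsMPAction d T μ ∧
    ∀ A : Set X, MeasurableSet A →
      (∀ v, μ ((T v ⁻¹' A) ∆ A) = 0) → μ A = 0 ∨ μ A = 1

/-- Ergodicity of the restricted `kℤ^d`-action `(T (k•v))_{v ∈ ℤ^d}` with respect to `ν`. -/
def SubActionErgodic {X : Type} [MeasurableSpace X] (d k : ℕ)
    (T : (Fin d → ℤ) → X → X) (ν : Measure X) : Prop :=
  ∀ B : Set X, MeasurableSet B →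
    (∀ v : Fin d → ℤ, ν ((T ((k : ℤ) • v) ⁻¹' B) ∆ B) = 0) → ν B = 0 ∨ ν B = 1

/-- A `T^k`-ergodic component of `μ`: a normalized restriction `ν = μ(· ∩ C)/μ(C)` to a
`kℤ^d`-invariant (mod null sets) set `C` of positive measure such that the restricted
`kℤ^d`-action is ergodic with respect to `ν`. -/
def IsErgodicComponent {X : Type} [MeasurableSpace X] (d k : ℕ)
    (T : (Fin d → ℤ) → X → X) (μ ν : Measure X) : Prop :=
  ∃ C : Set X, MeasurableSet C ∧ 0 < μ C ∧
    (∀ v : Fin d → ℤ, μ ((T ((k : ℤ) • v) ⁻¹' C) ∆ C) = 0) ∧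
    ν = (μ C)⁻¹ • μ.restrict C ∧
    SubActionErgodic d k T ν

section HilbertSpace

variable {E : Type*} [NormedAddCommGroup E]

/-- The averages of `u` over `[0, N)` eventually have norm at most `η`. -/
def HasSmallMeans (u : ℕ → E) (η : ℝ) : Prop :=
  ∀ᶠ N : ℕ in atTop, ‖∑ n ∈ Finset.range N, u n‖ ≤ η * N

lemma HasSmallMeans.add {u v : ℕ → E} {η θ : ℝ} (hu : HasSmallMeans u η)
    (hv : HasSmallMeans v θ) : HasSmallMeans (fun n => u n + v n) (η + θ) := by
  filter_upwards [hu, hv] with N h1 h2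
  rw [Finset.sum_add_distrib, add_mul]
  exact (norm_add_le _ _).trans (add_le_add h1 h2)

lemma norm_sum_shift_sub_le {u : ℕ → E} (hu : ∀ n, ‖u n‖ ≤ 1) (N t : ℕ) :
    ‖∑ n ∈ Finset.range N, u (n + t) - ∑ n ∈ Finset.range N, u n‖ ≤ 2 * t := by
  induction t with
  | zero => simp
  | succ t ih =>
    have h : ∑ n ∈ Finset.range N, u (n + (t + 1)) - ∑ n ∈ Finset.range N, u n =
        (∑ n ∈ Finset.range N, u (n + t) - ∑ n ∈ Finset.range N, u n) + (u (N + t) - u t) := by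
      have h1 := Finset.sum_range_succ' (fun n => u (n + t)) N
      rw [Finset.sum_range_succ] at h1
      have h2 : ∑ n ∈ Finset.range N, u (n + (t + 1)) =
          ∑ n ∈ Finset.range N, u (n + t) + u (N + t) - u t := by
        rw [h1]; simp [add_comm, add_left_comm]
      rw [h2]; abel
    rw [h]
    have := norm_sub_le (u (N + t)) (u t)
    have := norm_add_le (∑ n ∈ Finset.range N, u (n + t) - ∑ n ∈ Finset.range N, u n)
      (u (N + t) - u t)
    have := hu (N + t)
    have := hu t
    push_cast
    linarith

lemma norm_sum_sq_le (N : ℕ) (w : ℕ → E) :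
    ‖∑ n ∈ Finset.range N, w n‖ ^ 2 ≤ N * ∑ n ∈ Finset.range N, ‖w n‖ ^ 2 := by
  have h1 : ‖∑ n ∈ Finset.range N, w n‖ ≤ ∑ n ∈ Finset.range N, ‖w n‖ := norm_sum_le _ _
  have h2 := sq_sum_le_card_mul_sum_sq (s := Finset.range N) (f := fun n => ‖w n‖)
  rw [Finset.card_range] at h2
  exact (pow_le_pow_left₀ (norm_nonneg _) h1 2).trans h2

lemma norm_nsmul_sum_sub_le {u : ℕ → E} (hu : ∀ n, ‖u n‖ ≤ 1) (N K M : ℕ) :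
    ‖K • ∑ n ∈ Finset.range N, u n -
      ∑ n ∈ Finset.range N, ∑ h ∈ Finset.range K, u (n + M * h)‖ ≤ 2 * M * K ^ 2 := by
  rw [Finset.sum_comm]
  have h1 : K • ∑ n ∈ Finset.range N, u n =
      ∑ h ∈ Finset.range K, ∑ n ∈ Finset.range N, u n := by simp
  rw [h1, ← Finset.sum_sub_distrib]
  calc _ ≤ ∑ h ∈ Finset.range K, (2 * M * K : ℝ) := by
        refine norm_sum_le_of_le _ fun h hh => ?_
        rw [norm_sub_rev]
        refine (norm_sum_shift_sub_le hu N (M * h)).trans ?_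
        have : (h : ℝ) ≤ K := by exact_mod_cast (Finset.mem_range.1 hh).le
        push_cast
        rw [← mul_assoc]
        gcongr
    _ = _ := by simp; ring

variable [NormedSpace ℝ E]

/-- Small means of the block sums along an arithmetic progression give small means. -/
lemma HasSmallMeans.of_window {u : ℕ → E} (hu : ∀ n, ‖u n‖ ≤ 1) {η : ℝ} (hη : 0 < η) {K : ℕ}
    (hK : 0 < K) (M : ℕ)
    (h : HasSmallMeans (fun n => ∑ h ∈ Finset.range K, u (n + M * h)) (K * (η / 2))) :
    HasSmallMeans u η := by
  have hK' : (0 : ℝ) < K := by exact_mod_cast hK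
  have hlim : ∀ᶠ N : ℕ in atTop, (2 * M * K ^ 2 : ℝ) / (K * (η / 2)) ≤ N :=
    tendsto_natCast_atTop_atTop.eventually_ge_atTop _
  filter_upwards [h, hlim] with N h1 h2
  rw [div_le_iff₀ (by positivity)] at h2
  have h3 := norm_nsmul_sum_sub_le hu N K M
  have h4 := norm_add_le (K • ∑ n ∈ Finset.range N, u n -
      ∑ n ∈ Finset.range N, ∑ h ∈ Finset.range K, u (n + M * h))
      (∑ n ∈ Finset.range N, ∑ h ∈ Finset.range K, u (n + M * h))
  rw [sub_add_cancel, ← Nat.cast_smul_eq_nsmul ℝ, norm_smul, Real.norm_natCast] at h4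
  rw [← Nat.cast_smul_eq_nsmul ℝ] at h3
  have : (K : ℝ) * ‖∑ n ∈ Finset.range N, u n‖ ≤ K * (η * N) := by linarith
  exact le_of_mul_le_mul_left this hK'

/-- **Van der Corput's lemma.** -/
lemma exists_hasSmallMeans_of_inner {η : ℝ} (hη : 0 < η) :
    ∃ K : ℕ, 0 < K ∧ ∃ θ : ℝ, 0 < θ ∧ ∀ (E : Type) [NormedAddCommGroup E]
      [InnerProductSpace ℝ E] (u : ℕ → E), (∀ n, ‖u n‖ ≤ 1) →
      (∀ t, 0 < t → t < K → HasSmallMeans (fun n => inner ℝ (u (n + t)) (u n)) θ) →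
      HasSmallMeans u η := by
  obtain ⟨K, hK⟩ := exists_nat_gt (16 / η ^ 2)
  have hK0 : (0 : ℝ) < K := lt_trans (by positivity) hK
  have hKη : 16 < K * η ^ 2 := (div_lt_iff₀ (by positivity)).1 hK
  refine ⟨K, by exact_mod_cast hK0, η ^ 2 / 16, by positivity, fun E _ _ u hu h => ?_⟩
  refine HasSmallMeans.of_window hu hη (K := K) (by exact_mod_cast hK0) 1 ?_
  have hlim : ∀ᶠ N : ℕ in atTop, (2 * K : ℝ) / (η ^ 2 / 16) ≤ N :=
    tendsto_natCast_atTop_atTop.eventually_ge_atTop _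
  have hall : ∀ᶠ N : ℕ in atTop, ∀ t ∈ Finset.range K, 0 < t →
      ‖∑ n ∈ Finset.range N, inner ℝ (u (n + t)) (u n)‖ ≤ η ^ 2 / 16 * N := by
    rw [Filter.eventually_all_finset]
    intro t ht
    by_cases h0 : 0 < t
    · filter_upwards [h t h0 (Finset.mem_range.1 ht)] with N hN _ using hN
    · exact Eventually.of_forall fun N h1 => absurd h1 h0
  filter_upwards [hlim, hall] with N h1 h2
  rw [div_le_iff₀ (by positivity)] at h1
  have hinner : ∀ m n, ‖inner ℝ (u m) (u n)‖ ≤ 1 := fun m n =>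
    (norm_inner_le_norm _ _).trans (mul_le_one₀ (hu m) (norm_nonneg _) (hu n))
  have hlt : ∀ a b, a < b → b < K →
      ∑ n ∈ Finset.range N, inner ℝ (u (n + b)) (u (n + a)) ≤ η ^ 2 / 8 * N := by
    intro a b hab hb
    have h3 := norm_sum_shift_sub_le (u := fun n => inner ℝ (u (n + (b - a))) (u n))
      (fun n => hinner _ _) N a
    have h4 := h2 (b - a) (Finset.mem_range.2 (by omega)) (by omega)
    have h5 : ∀ n, n + a + (b - a) = n + b := fun n => by omega
    simp only [h5] at h3
    have h6 := (abs_le.1 ((Real.norm_eq_abs _).symm.le.trans h3)).2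
    have h7 := (abs_le.1 ((Real.norm_eq_abs _).symm.le.trans h4)).2
    have : (a : ℝ) ≤ K := by exact_mod_cast (hab.trans hb).le
    linarith
  have hpair : ∀ a ∈ Finset.range K, ∀ b ∈ Finset.range K,
      ∑ n ∈ Finset.range N, inner ℝ (u (n + 1 * a)) (u (n + 1 * b)) ≤
        (if a = b then (N : ℝ) else 0) + η ^ 2 / 8 * N := by
    intro a ha b hb
    simp only [one_mul]
    rcases lt_trichotomy a b with hab | rfl | hab
    · simp only [hab.ne, if_false, zero_add]
      have := hlt a b hab (Finset.mem_range.1 hb)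
      simpa only [real_inner_comm] using this
    · have : ∑ n ∈ Finset.range N, inner ℝ (u (n + a)) (u (n + a)) ≤ N := by
        calc _ ≤ ∑ n ∈ Finset.range N, (1 : ℝ) :=
              Finset.sum_le_sum fun n _ => (le_abs_self _).trans (hinner _ _)
          _ = _ := by simp
      simp only [if_true]
      have : 0 ≤ η ^ 2 / 8 * N := by positivity
      linarith
    · simp only [hab.ne', if_false, zero_add]
      exact hlt b a hab (Finset.mem_range.1 ha)
  have hsq : ‖∑ n ∈ Finset.range N, ∑ h ∈ Finset.range K, u (n + 1 * h)‖ ^ 2 ≤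
      (K * (η / 2) * N) ^ 2 := by
    calc _ ≤ N * ∑ n ∈ Finset.range N, ‖∑ h ∈ Finset.range K, u (n + 1 * h)‖ ^ 2 :=
          norm_sum_sq_le _ _
      _ = N * ∑ a ∈ Finset.range K, ∑ b ∈ Finset.range K, ∑ n ∈ Finset.range N,
            inner ℝ (u (n + 1 * a)) (u (n + 1 * b)) := by
          congr 1
          simp only [← real_inner_self_eq_norm_sq, sum_inner, inner_sum]
          rw [Finset.sum_comm]
          refine Finset.sum_congr rfl fun a _ => ?_
          rw [Finset.sum_comm]
          exact Finset.sum_congr rfl fun b _ => Finset.sum_congr rfl fun n _ =>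
            real_inner_comm _ _
      _ ≤ N * ∑ a ∈ Finset.range K, ∑ b ∈ Finset.range K,
            ((if a = b then (N : ℝ) else 0) + η ^ 2 / 8 * N) := by
          gcongr with a ha b hb
          exact hpair a ha b hb
      _ = N ^ 2 * K * (1 + K * (η ^ 2 / 8)) := by
          have : ∀ a ∈ Finset.range K, ∑ b ∈ Finset.range K,
              ((if a = b then (N : ℝ) else 0) + η ^ 2 / 8 * N) = N + K * (η ^ 2 / 8 * N) := by
            intro a ha
            rw [Finset.sum_add_distrib, Finset.sum_ite_eq, if_pos ha]
            simp
          rw [Finset.sum_congr rfl this]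
          simp
          ring
      _ ≤ N ^ 2 * K * (K * (η ^ 2 / 4)) := by
          gcongr
          linarith
      _ = _ := by ring
  exact le_of_sq_le_sq hsq (by positivity)

end HilbertSpace

section Representation

variable {G : Type} {H : Type} [NormedAddCommGroup H] [InnerProductSpace ℝ H]

lemma norm_sub_starProjection_le (Z : Submodule ℝ H) [Z.HasOrthogonalProjection] (f : H) :
    ‖f - Z.starProjection f‖ ≤ ‖f‖ := by
  rw [← Submodule.starProjection_orthogonal_val]
  exact Zᗮ.norm_starProjection_apply_le f

/-- The vectors fixed by all elements of `S`. -/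
def fixedVectors (U : G → H →ₗᵢ[ℝ] H) (S : Set G) : Submodule ℝ H :=
  ⨅ g ∈ S, LinearMap.eqLocus (U g).toLinearMap LinearMap.id

variable {U : G → H →ₗᵢ[ℝ] H}

lemma mem_fixedVectors {S : Set G} {v : H} : v ∈ fixedVectors U S ↔ ∀ g ∈ S, U g v = v := by
  simp [fixedVectors, Submodule.mem_iInf, LinearMap.mem_eqLocus]

lemma isClosed_fixedVectors (S : Set G) : IsClosed (fixedVectors U S : Set H) := by
  have : (fixedVectors U S : Set H) = ⋂ g ∈ S, {v | U g v = v} := by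
    ext v; simp [mem_fixedVectors]
  rw [this]
  exact isClosed_biInter fun g _ => isClosed_eq (U g).continuous continuous_id

instance [CompleteSpace H] (S : Set G) : CompleteSpace (fixedVectors U S) :=
  (isClosed_fixedVectors S).completeSpace_coe

variable [AddCommGroup G]

/-- `U` is an isometric representation of the additive group `G`. -/
structure IsIsometricRep (U : G → H →ₗᵢ[ℝ] H) : Prop where
  map_zero : ∀ x, U 0 x = x
  map_add : ∀ g h x, U (g + h) x = U g (U h x)

/-- The subgroup of elements of `G` fixing the vector `v`. -/
def fixer (hU : IsIsometricRep U) (v : H) : AddSubgroup G where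
  carrier := {g | U g v = v}
  zero_mem' := hU.map_zero v
  add_mem' {a b} ha hb := by
    simp only [Set.mem_ofPred_eq] at *
    rw [hU.map_add, hb, ha]
  neg_mem' {a} ha := by
    simp only [Set.mem_ofPred_eq] at *
    conv_lhs => rw [← ha]
    rw [← hU.map_add, neg_add_cancel, hU.map_zero]

lemma IsIsometricRep.inner_eq (hU : IsIsometricRep U) (g : G) (x y : H) :
    inner ℝ (U g x) y = inner ℝ x (U (-g) y) := by
  rw [← (U g).inner_map_map x, ← hU.map_add, add_neg_cancel, hU.map_zero]

lemma IsIsometricRep.comm (hU : IsIsometricRep U) (g h : G) (x : H) :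
    U g (U h x) = U h (U g x) := by
  rw [← hU.map_add, add_comm, hU.map_add]

/-- The means of `h ↦ U (h • g) v` tend to zero if `v` is orthogonal to those `w` which are fixed
by `g` and by every element fixing `v`. -/
lemma hasSmallMeans_smul [CompleteSpace H] (hU : IsIsometricRep U) (g : G) (v : H)
    (hv : ∀ w, U g w = w → (∀ g', U g' v = v → U g' w = w) → inner ℝ v w = 0)
    {η : ℝ} (hη : 0 < η) : HasSmallMeans (fun n : ℕ => U (n • g) v) η := by
  have hlim := ContinuousLinearMap.tendsto_birkhoffAverage_orthogonalProjection
    (U g).toContinuousLinearMap (U g).norm_toContinuousLinearMap_le v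
  set w : H := ↑(((U g).toContinuousLinearMap : H →ₗ[ℝ] H).eqLocus
    (1 : H →L[ℝ] H) |>.orthogonalProjectionOnto v) with hw
  have hiter : ∀ n : ℕ, (U g)^[n] v = U (n • g) v := by
    intro n
    induction n with
    | zero => simp [hU.map_zero]
    | succ n ih => rw [Function.iterate_succ_apply', ih, succ_nsmul', hU.map_add]
  have hbirk : ∀ N : ℕ, birkhoffAverage ℝ (U g).toContinuousLinearMap id N v =
      (N : ℝ)⁻¹ • ∑ n ∈ Finset.range N, U (n • g) v := by
    intro N
    simp [birkhoffAverage, birkhoffSum, hiter]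
  have hgw : U g w = w := by
    have := (((U g).toContinuousLinearMap : H →ₗ[ℝ] H).eqLocus
      (1 : H →L[ℝ] H) |>.orthogonalProjectionOnto v).2
    exact this
  have hfix : ∀ g', U g' v = v → U g' w = w := by
    intro g' hg'
    refine tendsto_nhds_unique (((U g').continuous.tendsto w).comp hlim)
      (hlim.congr fun N => ?_)
    simp only [Function.comp_apply]
    rw [hbirk, map_smul, map_sum]
    simp only [hU.comm g', hg']
  have hvw : inner ℝ v w = 0 := hv w hgw hfix
  have hw0 : w = 0 := by
    have h1 : inner ℝ (v - w) w = 0 :=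
      Submodule.starProjection_inner_eq_zero v w (Submodule.coe_mem _)
    rw [inner_sub_left, hvw, zero_sub, neg_eq_zero] at h1
    exact inner_self_eq_zero.1 h1
  rw [hw0] at hlim
  have := (tendsto_zero_iff_norm_tendsto_zero.1 hlim).eventually_lt_const hη
  filter_upwards [this, eventually_gt_atTop 0] with N hN hN0
  have hN0' : (0 : ℝ) < N := by exact_mod_cast hN0
  rw [hbirk, norm_smul, norm_inv, Real.norm_natCast, inv_mul_lt_iff₀ hN0'] at hN
  linarith

/-- The polynomial sequence `n ↦ ∑ j < D, n ^ (j + 1) • a j`. -/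
def polySeq (D : ℕ) (a : ℕ → G) (n : ℕ) : G := ∑ j ∈ Finset.range D, (n ^ (j + 1)) • a j

/-- The coefficients of the `t`-th difference of a polynomial sequence. -/
def diffCoeff (D t : ℕ) (a : ℕ → G) (i : ℕ) : G :=
  ∑ j ∈ Finset.Ioo i D, ((j + 1).choose (i + 1) * t ^ (j - i)) • a j

lemma polySeq_shift (D t : ℕ) (a : ℕ → G) (n : ℕ) :
    polySeq (D + 1) a (n + t) = polySeq (D + 1) a n +
      (polySeq (D + 1) a t + polySeq D (diffCoeff (D + 1) t a) n) := by
  have h1 : polySeq D (diffCoeff (D + 1) t a) n = ∑ j ∈ Finset.range (D + 1),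
      (∑ i ∈ Finset.range j, n ^ (i + 1) * ((j + 1).choose (i + 1) * t ^ (j - i))) • a j := by
    simp only [polySeq, diffCoeff, Finset.smul_sum, Finset.sum_smul, smul_smul]
    refine Finset.sum_comm' fun i j => ?_
    simp only [Finset.mem_range, Finset.mem_Ioo]
    omega
  rw [h1]
  simp only [polySeq, ← Finset.sum_add_distrib, ← add_smul]
  refine Finset.sum_congr rfl fun j _ => ?_
  congr 1
  rw [add_pow, Finset.sum_range_succ, Finset.sum_range_succ']
  simp only [Nat.choose_self, Nat.choose_zero_right, Nat.cast_id, tsub_self, pow_zero, mul_one,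
    one_mul, tsub_zero, Nat.add_sub_add_right]
  have : ∀ i, n ^ (i + 1) * t ^ (j - i) * (j + 1).choose (i + 1) =
    n ^ (i + 1) * ((j + 1).choose (i + 1) * t ^ (j - i)) := fun i => by ring
  simp only [this]
  ring

/-- A subgroup containing fixed multiples of the coefficients of a difference contains fixed
multiples of all but the first coefficient. -/
lemma exists_smul_mem_of_diffCoeff (D L t : ℕ) (hL : 0 < L) (ht : 0 < t) :
    ∃ M : ℕ, 0 < M ∧ ∀ (S : AddSubgroup G) (a : ℕ → G),
      (∀ i < D, L • diffCoeff (D + 1) t a i ∈ S) → ∀ j, 1 ≤ j → j ≤ D → M • a j ∈ S := by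
  suffices h : ∀ m ≤ D, ∃ M : ℕ, 0 < M ∧ ∀ (S : AddSubgroup G) (a : ℕ → G),
      (∀ i < D, L • diffCoeff (D + 1) t a i ∈ S) → ∀ j, D - m < j → j ≤ D → M • a j ∈ S by
    obtain ⟨M, hM, h⟩ := h D le_rfl
    exact ⟨M, hM, fun S a hS j h1 h2 => h S a hS j (by omega) h2⟩
  intro m
  induction m with
  | zero => exact fun _ => ⟨1, one_pos, fun S a _ j h1 h2 => by omega⟩
  | succ m ih =>
    intro hm
    obtain ⟨M, hM, ih⟩ := ih (by omega)
    set i := D - (m + 1) with hi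
    have hDm : D - m = i + 1 := by omega
    refine ⟨M * (L * ((i + 1 + 1) * t)), by positivity, fun S a hS j h1 h2 => ?_⟩
    rcases eq_or_lt_of_le (Nat.succ_le_of_lt h1) with rfl | hj
    · have hmem : (M * L) • diffCoeff (D + 1) t a i ∈ S := by
        rw [mul_smul]; exact S.nsmul_mem (hS i (by omega)) M
      have hIoo : Finset.Ioo i (D + 1) = insert (i + 1) (Finset.Ioo (i + 1) (D + 1)) := by
        ext x; simp only [Finset.mem_Ioo, Finset.mem_insert]; omega
      rw [diffCoeff, hIoo, Finset.sum_insert (by simp), smul_add] at hmem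
      have hrest : (M * L) • ∑ x ∈ Finset.Ioo (i + 1) (D + 1),
          ((x + 1).choose (i + 1) * t ^ (x - i)) • a x ∈ S := by
        rw [Finset.smul_sum]
        refine S.sum_mem fun x hx => ?_
        rw [Finset.mem_Ioo] at hx
        rw [smul_smul, mul_comm M L, mul_right_comm, mul_smul]
        exact S.nsmul_mem (ih S a hS x (by omega) (by omega)) _
      have := (S.add_mem_cancel_right hrest).1 hmem
      rw [smul_smul, Nat.choose_succ_self_right] at this
      convert this using 2
      simp
      ring
    · rw [mul_comm, mul_smul]
      exact S.nsmul_mem (ih S a hS j (by omega) h2) _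

/-- The same with a multiple that works for all differences with small step. -/
lemma exists_smul_mem_of_diffCoeff_uniform (D L K : ℕ) (hL : 0 < L) :
    ∃ M : ℕ, 0 < M ∧ ∀ t, 0 < t → t < K → ∀ (S : AddSubgroup G) (a : ℕ → G),
      (∀ i < D, L • diffCoeff (D + 1) t a i ∈ S) → ∀ j, 1 ≤ j → j ≤ D → M • a j ∈ S := by
  induction K with
  | zero => exact ⟨1, one_pos, fun t _ h => by omega⟩
  | succ K ih =>
    obtain ⟨M, hM, ih⟩ := ih
    rcases Nat.eq_zero_or_pos K with rfl | hK
    · exact ⟨1, one_pos, fun t _ h => by omega⟩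
    obtain ⟨M', hM', h'⟩ := exists_smul_mem_of_diffCoeff (G := G) D L K hL hK
    refine ⟨M * M', by positivity, fun t h0 ht S a hS j h1 h2 => ?_⟩
    rcases eq_or_lt_of_le (Nat.le_of_lt_succ ht) with rfl | htK
    · rw [mul_smul]
      exact S.nsmul_mem (h' S a hS j h1 h2) M
    · rw [mul_comm, mul_smul]
      exact S.nsmul_mem (ih t h0 htK S a hS j h1 h2) M'

lemma IsIsometricRep.shift_polySeq_fixed (hU : IsIsometricRep U) {D M : ℕ} {a : ℕ → G} {v : H}
    (hv : ∀ j, 1 ≤ j → j ≤ D → U (M • a j) v = v) (n h : ℕ) :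
    U (polySeq (D + 1) a (n + M * h)) v =
      U (polySeq (D + 1) a n) (U (h • (M • a 0)) v) := by
  have hmem : polySeq (D + 1) a (n + M * h) - (polySeq (D + 1) a n + h • (M • a 0)) ∈
      fixer hU v := by
    have key : ∀ j ∈ Finset.range D, ∃ c : ℕ,
        (n + M * h) ^ (j + 1 + 1) = n ^ (j + 1 + 1) + c * M := by
      intro j _
      have h1 : n ^ (j + 1 + 1) ≤ (n + M * h) ^ (j + 1 + 1) :=
        Nat.pow_le_pow_left (Nat.le_add_right _ _) _
      have h2 : M ∣ (n + M * h) ^ (j + 1 + 1) - n ^ (j + 1 + 1) := by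
        refine (Nat.modEq_iff_dvd' h1).1 ?_
        refine Nat.ModEq.pow _ ?_
        simp [Nat.ModEq]
      obtain ⟨c, hc⟩ := h2
      exact ⟨c, by rw [mul_comm c]; omega⟩
    simp only [polySeq, Finset.sum_range_succ']
    have h0 : (n + M * h) ^ (0 + 1) • a 0 = n ^ (0 + 1) • a 0 + h • M • a 0 := by
      rw [smul_smul, ← add_smul]; congr 1; ring
    rw [h0]
    have : ∀ x y z w : G, x + (y + z) - (w + y + z) = x - w := fun x y z w => by abel
    rw [this, ← Finset.sum_sub_distrib]
    refine AddSubgroup.sum_mem _ fun j hj => ?_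
    obtain ⟨c, hc⟩ := key j hj
    rw [hc, add_smul, add_sub_cancel_left, mul_smul]
    refine AddSubgroup.nsmul_mem _ ?_ c
    exact hv (j + 1) (by omega) (by have := Finset.mem_range.1 hj; omega)
  rw [← hU.map_add]
  have h2 : U (polySeq (D + 1) a (n + M * h) - (polySeq (D + 1) a n + h • (M • a 0))) v = v := hmem
  conv_rhs => rw [← h2]
  rw [← hU.map_add]
  congr 1
  abel_nf

/-- **Polynomial mean ergodic theorem, with uniform torsion.** The means of a vector along a
polynomial orbit are small once it is orthogonal to the vectors fixed by a multiple of all the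
coefficients; this multiple depends only on the degree and the required precision. -/
theorem exists_hasSmallMeans_polySeq (G : Type) [AddCommGroup G] (D : ℕ) :
    ∀ η : ℝ, 0 < η → ∃ L : ℕ, 0 < L ∧ ∀ (H : Type) [NormedAddCommGroup H]
      [InnerProductSpace ℝ H] [CompleteSpace H] (U : G → H →ₗᵢ[ℝ] H), IsIsometricRep U →
      ∀ (a : ℕ → G) (f : H), ‖f‖ ≤ 1 →
      (∀ w, (∀ j < D, U (L • a j) w = w) → inner ℝ f w = 0) →
      HasSmallMeans (fun n => U (polySeq D a n) f) η := by
  induction D with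
  | zero =>
    intro η hη
    refine ⟨1, one_pos, fun H _ _ _ U hU a f _ hf => ?_⟩
    have : f = 0 := inner_self_eq_zero.1 (hf f (by simp))
    subst this
    refine Eventually.of_forall fun N => ?_
    simp only [map_zero, Finset.sum_const_zero, norm_zero]
    positivity
  | succ D ih =>
    intro η hη
    obtain ⟨K, hK, θ, hθ, hvdc⟩ := exists_hasSmallMeans_of_inner (half_pos hη)
    obtain ⟨L, hL, hIH⟩ := ih θ hθ
    obtain ⟨M, hM, hML⟩ := exists_smul_mem_of_diffCoeff_uniform (G := G) D L K hL
    refine ⟨M, hM, fun H _ _ _ U hU a f hf1 hf => ?_⟩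
    let Z := fixedVectors U {g | ∃ j, 1 ≤ j ∧ j ≤ D ∧ g = M • a j}
    have hZ : ∀ w, w ∈ Z ↔ ∀ j, 1 ≤ j → j ≤ D → U (M • a j) w = w := by
      intro w
      rw [mem_fixedVectors]
      constructor
      · exact fun h j h1 h2 => h _ ⟨j, h1, h2, rfl⟩
      · rintro h _ ⟨j, h1, h2, rfl⟩
        exact h j h1 h2
    set f₁ : H := Z.starProjection f with hf₁
    have hf₁Z : f₁ ∈ Z := Z.starProjection_apply_mem f
    have horth : ∀ w ∈ Z, inner ℝ (f - f₁) w = 0 := Z.starProjection_inner_eq_zero f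
    have hf₁1 : ‖f₁‖ ≤ 1 := (Z.norm_starProjection_apply_le f).trans hf1
    have hf₂1 : ‖f - f₁‖ ≤ 1 := (norm_sub_starProjection_le Z f).trans hf1
    have hsplit : (fun n => U (polySeq (D + 1) a n) f) = fun n =>
        U (polySeq (D + 1) a n) (f - f₁) + U (polySeq (D + 1) a n) f₁ := by
      funext n; rw [← map_add, sub_add_cancel]
    rw [hsplit, ← add_halves η]
    refine HasSmallMeans.add ?_ ?_
    · refine hvdc H _ (fun n => by rw [LinearIsometry.norm_map]; exact hf₂1) fun t ht0 htK => ?_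
      have hsmall := hIH H U hU (diffCoeff (D + 1) t a) (f - f₁) hf₂1 fun w hw => by
        refine horth w ((hZ w).2 fun j h1 h2 => ?_)
        exact hML t ht0 htK (fixer hU w) a hw j h1 h2
      filter_upwards [hsmall] with N hN
      have heq : ∀ n, inner ℝ (U (polySeq (D + 1) a (n + t)) (f - f₁))
          (U (polySeq (D + 1) a n) (f - f₁)) =
          inner ℝ (U (polySeq D (diffCoeff (D + 1) t a) n) (f - f₁))
            (U (-polySeq (D + 1) a t) (f - f₁)) := by
        intro n
        rw [polySeq_shift, hU.map_add, LinearIsometry.inner_map_map, hU.map_add, hU.inner_eq]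
      simp only [heq, ← sum_inner]
      refine (norm_inner_le_norm _ _).trans ?_
      rw [LinearIsometry.norm_map]
      exact (mul_le_of_le_one_right (norm_nonneg _) hf₂1).trans hN
    · have hmean := hasSmallMeans_smul hU (M • a 0) f₁ (fun w hw0 hw => by
        have hwZ : ∀ j, 1 ≤ j → j ≤ D → U (M • a j) w = w := fun j h1 h2 =>
          hw _ ((hZ f₁).1 hf₁Z j h1 h2)
        have h1 := horth w ((hZ w).2 hwZ)
        rw [inner_sub_left, hf w (fun j hj => ?_)] at h1
        · linarith
        · rcases Nat.eq_zero_or_pos j with rfl | hj0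
          · exact hw0
          · exact hwZ j hj0 (by omega)) (half_pos (half_pos hη))
      obtain ⟨B, hB, hB0⟩ := (hmean.and (eventually_gt_atTop 0)).exists
      refine HasSmallMeans.of_window (fun n => by rw [LinearIsometry.norm_map]; exact hf₁1)
        (half_pos hη) hB0 M (Eventually.of_forall fun N => ?_)
      calc _ ≤ ∑ n ∈ Finset.range N, (B * (η / 2 / 2) : ℝ) := by
            refine norm_sum_le_of_le _ fun n _ => ?_
            simp only [hU.shift_polySeq_fixed ((hZ f₁).1 hf₁Z), ← map_sum,
              LinearIsometry.norm_map]
            linarith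
        _ = _ := by simp; ring

end Representation

section Curve

lemma coeff_aeval_X_pow {r B : ℕ} (p : MvPolynomial (Fin r) ℤ)
    (hp : ∀ s ∈ p.support, ∀ j, s j < B) (s : Fin r →₀ ℕ) (hs : ∀ j, s j < B) :
    (MvPolynomial.aeval (fun j : Fin r => (Polynomial.X : Polynomial ℤ) ^ B ^ (j : ℕ)) p).coeff
      (∑ j, s j * B ^ (j : ℕ)) = p.coeff s := by
  have hmon : ∀ u : Fin r →₀ ℕ, ∏ j : Fin r, ((Polynomial.X : Polynomial ℤ) ^ B ^ (j : ℕ)) ^ u j =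
      Polynomial.X ^ ∑ j : Fin r, u j * B ^ (j : ℕ) := by
    intro u
    rw [← Finset.prod_pow_eq_pow_sum]
    exact Finset.prod_congr rfl fun j _ => by rw [← pow_mul, mul_comm]
  have hinj : ∀ u : Fin r →₀ ℕ, (∀ j, u j < B) →
      ∑ j, s j * B ^ (j : ℕ) = ∑ j, u j * B ^ (j : ℕ) → s = u := by
    intro u hu h
    have h1 : finFunctionFinEquiv (fun j => (⟨s j, hs j⟩ : Fin B)) =
        finFunctionFinEquiv (fun j => (⟨u j, hu j⟩ : Fin B)) := by
      apply Fin.ext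
      simpa only [finFunctionFinEquiv_apply] using h
    ext j
    exact congrArg Fin.val (congrFun (finFunctionFinEquiv.injective h1) j)
  rw [MvPolynomial.aeval_def, MvPolynomial.eval₂_eq', Polynomial.finsetSum_coeff]
  simp only [hmon, Polynomial.algebraMap_eq, Polynomial.coeff_C_mul, Polynomial.coeff_X_pow]
  rw [Finset.sum_eq_single s]
  · simp
  · intro u hu hne
    rw [if_neg fun h => hne (hinj u (hp u hu) h).symm, mul_zero]
  · intro h
    rw [MvPolynomial.notMem_support_iff.1 h, zero_mul]

/-- Integer vectors spanning `ℚ ^ d` generate a subgroup of finite exponent in `ℤ ^ d`. -/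
lemma exists_smul_mem_of_forall_orthogonal {d : ℕ} (A : Set (Fin d → ℤ))
    (hA : ∀ c : Fin d → ℚ, (∀ v ∈ A, ∑ i, c i * (v i : ℚ) = 0) → c = 0) :
    ∃ Q : ℕ, 0 < Q ∧ ∀ v, Q • v ∈ AddSubgroup.closure A := by
  have htop : Submodule.span ℚ ((fun v : Fin d → ℤ => fun i => (v i : ℚ)) '' A) = ⊤ := by
    by_contra h
    obtain ⟨φ, hφ, hle⟩ := Submodule.exists_le_ker_of_lt_top _ (lt_top_iff_ne_top.2 h)
    have hexp : ∀ x : Fin d → ℚ, φ x = ∑ i, φ (Pi.single i 1) * x i := by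
      intro x
      conv_lhs => rw [pi_eq_sum_univ' x]
      simp only [map_sum, map_smul, smul_eq_mul]
      refine Finset.sum_congr rfl fun i _ => ?_
      rw [mul_comm]
    have hc := hA (fun i => φ (Pi.single i 1)) fun v hv => by
      rw [← hexp]
      exact hle (Submodule.subset_span ⟨v, hv, rfl⟩)
    refine hφ (LinearMap.ext fun x => ?_)
    rw [hexp]
    exact Finset.sum_eq_zero fun i _ => by rw [congrFun hc i]; simp
  have hmem : ∀ x : Fin d → ℚ, ∃ Q : ℕ, 0 < Q ∧ ∃ w ∈ AddSubgroup.closure A,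
      ∀ i, (w i : ℚ) = Q * x i := by
    intro x
    have hx : x ∈ Submodule.span ℚ ((fun v : Fin d → ℤ => fun i => (v i : ℚ)) '' A) := by
      rw [htop]; trivial
    induction hx using Submodule.span_induction with
    | mem x hx =>
      obtain ⟨v, hv, rfl⟩ := hx
      exact ⟨1, one_pos, v, AddSubgroup.subset_closure hv, fun i => by simp⟩
    | zero => exact ⟨1, one_pos, 0, zero_mem _, fun i => by simp⟩
    | add x y _ _ hx hy =>
      obtain ⟨Q, hQ, w, hw, h⟩ := hx
      obtain ⟨Q', hQ', w', hw', h'⟩ := hy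
      refine ⟨Q * Q', by positivity, Q' • w + Q • w',
        add_mem (AddSubgroup.nsmul_mem _ hw _) (AddSubgroup.nsmul_mem _ hw' _), fun i => ?_⟩
      simp [h, h']
      ring
    | smul c x _ hx =>
      obtain ⟨Q, hQ, w, hw, h⟩ := hx
      refine ⟨Q * c.den, mul_pos hQ c.den_pos, c.num • w, AddSubgroup.zsmul_mem _ hw _,
        fun i => ?_⟩
      have hc : (c.num : ℚ) = c * c.den := (Rat.mul_den_eq_num c).symm
      simp only [Pi.smul_apply, smul_eq_mul, Int.cast_mul, h, Nat.cast_mul, hc]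
      ring
  choose Q hQ w hw h using fun i : Fin d => hmem (Pi.single i 1)
  refine ⟨∏ i, Q i, Finset.prod_pos fun i _ => hQ i, fun v => ?_⟩
  have hbasis : ∀ i, Q i • (Pi.single i 1 : Fin d → ℤ) = w i := by
    intro i
    ext j
    have := h i j
    by_cases hij : j = i
    · subst hij
      simp only [Pi.single_eq_same, mul_one] at this
      simp only [Pi.smul_apply, Pi.single_eq_same, nsmul_eq_mul, mul_one]
      exact_mod_cast this.symm
    · simp only [Pi.single_eq_of_ne hij, mul_zero] at this
      simp only [Pi.smul_apply, Pi.single_eq_of_ne hij, smul_zero]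
      exact_mod_cast this.symm
  have hv : v = ∑ i, v i • (Pi.single i 1 : Fin d → ℤ) := by
    ext j
    simp [Finset.sum_apply, Pi.single_apply]
  rw [hv, Finset.smul_sum]
  refine AddSubgroup.sum_mem _ fun i _ => ?_
  rw [smul_comm, ← Finset.mul_prod_erase _ _ (Finset.mem_univ i), mul_comm, mul_smul, hbasis]
  exact AddSubgroup.zsmul_mem _ (AddSubgroup.nsmul_mem _ (hw i) _) _

/-- A polynomial map with linearly independent components and zero constant term, restricted to a
monomial curve, is a polynomial sequence whose coefficients span a subgroup of finite exponent. -/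
lemma exists_curve {r d : ℕ} (p : Fin d → MvPolynomial (Fin r) ℤ)
    (hp0 : ∀ i, MvPolynomial.constantCoeff (p i) = 0)
    (hind : LinearIndependent ℚ fun i => (p i).map (Int.castRingHom ℚ)) :
    ∃ (D : ℕ) (e : Fin r → ℕ) (a : ℕ → Fin d → ℤ) (Q : ℕ), 0 < Q ∧
      (∀ n : ℕ, (fun i => MvPolynomial.eval (fun j => (n : ℤ) ^ e j) (p i)) = polySeq D a n) ∧
      ∀ v, Q • v ∈ AddSubgroup.closure (a '' {j | j < D}) := by
  set B : ℕ := ∑ i, (p i).totalDegree + 1 with hB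
  have hdig : ∀ i, ∀ s ∈ (p i).support, ∀ j, s j < B := by
    intro i s hs j
    have h1 : s j ≤ (p i).totalDegree :=
      (MvPolynomial.monomial_le_degreeOf j hs).trans (MvPolynomial.degreeOf_le_totalDegree _ _)
    have h2 := Finset.single_le_sum (f := fun i => (p i).totalDegree)
      (fun _ _ => Nat.zero_le _) (Finset.mem_univ i)
    omega
  set q : Fin d → Polynomial ℤ := fun i =>
    MvPolynomial.aeval (fun j : Fin r => (Polynomial.X : Polynomial ℤ) ^ B ^ (j : ℕ)) (p i) with hq
  have hq0 : ∀ i, (q i).coeff 0 = 0 := by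
    intro i
    have := coeff_aeval_X_pow (p i) (hdig i) 0 (fun j => by simp [hB])
    simp only [Finsupp.coe_zero, Pi.zero_apply, zero_mul, Finset.sum_const_zero] at this
    rw [hq, this]
    exact hp0 i
  set D : ℕ := ∑ i, (q i).natDegree with hD
  have hDq : ∀ i, (q i).natDegree < D + 1 := by
    intro i
    have h2 := Finset.single_le_sum (f := fun i => (q i).natDegree)
      (fun _ _ => Nat.zero_le _) (Finset.mem_univ i)
    omega
  obtain ⟨Q, hQ, hQa⟩ := exists_smul_mem_of_forall_orthogonal
    ((fun j i => (q i).coeff (j + 1)) '' {j | j < D}) (fun c hc => by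
      have hcq : ∀ t, ∑ i, c i * ((q i).coeff t : ℚ) = 0 := by
        intro t
        rcases t with _ | t
        · exact Finset.sum_eq_zero fun i _ => by rw [hq0]; simp
        · by_cases ht : t < D
          · exact hc _ ⟨t, ht, rfl⟩
          · refine Finset.sum_eq_zero fun i _ => ?_
            rw [Polynomial.coeff_eq_zero_of_natDegree_lt (by have := hDq i; omega)]
            simp
      have hsum : ∑ i, c i • (p i).map (Int.castRingHom ℚ) = 0 := by
        ext s
        simp only [MvPolynomial.coeff_sum, MvPolynomial.coeff_smul, MvPolynomial.coeff_map,
          MvPolynomial.coeff_zero, smul_eq_mul, eq_intCast]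
        by_cases hs : ∀ j, s j < B
        · rw [← hcq (∑ j, s j * B ^ (j : ℕ))]
          refine Finset.sum_congr rfl fun i _ => ?_
          rw [hq, coeff_aeval_X_pow (p i) (hdig i) s hs]
        · refine Finset.sum_eq_zero fun i _ => ?_
          rw [MvPolynomial.notMem_support_iff.1 fun h => hs (hdig i s h)]
          simp
      exact funext fun i => Fintype.linearIndependent_iff.1 hind c hsum i)
  refine ⟨D, fun j => B ^ (j : ℕ), fun j i => (q i).coeff (j + 1), Q, hQ, fun n => ?_, hQa⟩
  funext i
  have heval : MvPolynomial.eval (fun j : Fin r => (n : ℤ) ^ B ^ (j : ℕ)) (p i) =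
      (q i).eval (n : ℤ) := by
    simp only [hq]
    rw [MvPolynomial.aeval_def, ← Polynomial.coe_evalRingHom, MvPolynomial.hom_eval₂]
    simp only [MvPolynomial.eval, Polynomial.coe_evalRingHom, Polynomial.eval_pow,
      Polynomial.eval_X]
    rw [RingHom.ext_int ((Polynomial.evalRingHom (n : ℤ)).comp (algebraMap ℤ (Polynomial ℤ)))
      (RingHom.id ℤ)]
    rfl
  rw [heval, Polynomial.eval_eq_sum_range' (hDq i), Finset.sum_range_succ', hq0]
  simp only [polySeq, Finset.sum_apply, nsmul_eq_mul, Nat.cast_pow]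
  simp [mul_comm]

lemma polySeq_mul {G : Type} [AddCommGroup G] (D k n : ℕ) (a : ℕ → G) :
    polySeq D a (k * n) = polySeq D (fun j => k ^ (j + 1) • a j) n := by
  simp only [polySeq, smul_smul, mul_pow, mul_comm]

lemma exists_polySeq_eq_smul {G : Type} [AddCommGroup G] (D k n : ℕ) (a : ℕ → G) :
    ∃ u, polySeq D (fun j => k ^ (j + 1) • a j) n = k • u :=
  ⟨polySeq D (fun j => k ^ j • a j) n, by
    simp only [polySeq, Finset.smul_sum, smul_smul]
    refine Finset.sum_congr rfl fun j _ => ?_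
    congr 1
    ring⟩

lemma smul_mem_of_smul_pow_smul_mem {G : Type} [AddCommGroup G] {D k L Q : ℕ} {a : ℕ → G}
    (hQ : ∀ v, Q • v ∈ AddSubgroup.closure (a '' {j | j < D})) (S : AddSubgroup G)
    (hS : ∀ j < D, L • k ^ (j + 1) • a j ∈ S) (v : G) : (L * k ^ D * Q) • v ∈ S := by
  have hle : AddSubgroup.closure (a '' {j | j < D}) ≤
      S.comap (nsmulAddMonoidHom (α := G) (L * k ^ D)) := by
    rw [AddSubgroup.closure_le]
    rintro _ ⟨j, hj, rfl⟩
    have hjD : j < D := hj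
    have hk : k ^ D = k ^ (D - (j + 1)) * k ^ (j + 1) := by rw [← pow_add]; congr 1; omega
    simp only [AddSubgroup.coe_comap, Set.mem_preimage, nsmulAddMonoidHom_apply, SetLike.mem_coe]
    rw [hk, mul_left_comm, mul_smul, mul_smul]
    exact S.nsmul_mem (hS j hjD) _
  rw [mul_smul]
  exact hle (hQ v)

end Curve

section Koopman

variable {X : Type} [MeasurableSpace X] {d : ℕ} {T : (Fin d → ℤ) → X → X} {μ : Measure X}

/-- The Koopman representation of a measure-preserving action on `L²`. -/
noncomputable def koopman (hT : IsMPAction d T μ) (v : Fin d → ℤ) :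
    Lp ℝ 2 μ →ₗᵢ[ℝ] Lp ℝ 2 μ :=
  Lp.compMeasurePreservingₗᵢ ℝ (T v) (hT.2.2 v)

lemma coeFn_koopman (hT : IsMPAction d T μ) (v : Fin d → ℤ) (f : Lp ℝ 2 μ) :
    koopman hT v f =ᵐ[μ] f ∘ T v :=
  Lp.coeFn_compMeasurePreserving f (hT.2.2 v)

lemma isIsometricRep_koopman (hT : IsMPAction d T μ) : IsIsometricRep (koopman hT) where
  map_zero f := by
    refine Lp.ext ((coeFn_koopman hT 0 f).trans ?_)
    rw [hT.1, Function.comp_id]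
  map_add v w f := by
    refine Lp.ext ((coeFn_koopman hT (v + w) f).trans ?_)
    refine EventuallyEq.trans ?_ (coeFn_koopman hT v _).symm
    rw [add_comm, hT.2.1, ← Function.comp_assoc]
    exact (hT.2.2 v).quasiMeasurePreserving.ae_eq_comp (coeFn_koopman hT w f).symm

lemma koopman_indicatorConstLp [IsFiniteMeasure μ] (hT : IsMPAction d T μ) (v : Fin d → ℤ)
    {s : Set X} (hs : MeasurableSet s) :
    koopman hT v (indicatorConstLp 2 hs (measure_ne_top μ s) (1 : ℝ)) =
      indicatorConstLp 2 ((hT.2.2 v).measurable hs) (measure_ne_top μ _) (1 : ℝ) :=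
  Lp.indicatorConstLp_compMeasurePreserving hs (measure_ne_top μ s) 1 (hT.2.2 v)

lemma koopman_indicatorConstLp_eq_self [IsFiniteMeasure μ] (hT : IsMPAction d T μ)
    {v : Fin d → ℤ} {s : Set X} (hs : MeasurableSet s) (h : T v ⁻¹' s =ᵐ[μ] s) :
    koopman hT v (indicatorConstLp 2 hs (measure_ne_top μ s) (1 : ℝ)) =
      indicatorConstLp 2 hs (measure_ne_top μ s) (1 : ℝ) := by
  rw [koopman_indicatorConstLp]
  refine Lp.ext (indicatorConstLp_coeFn.trans (EventuallyEq.trans ?_ indicatorConstLp_coeFn.symm))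
  exact indicator_ae_eq_of_ae_eq_set h

lemma preimage_superlevel_ae_eq (hT : IsMPAction d T μ) {v : Fin d → ℤ} {φ : Lp ℝ 2 μ}
    (h : koopman hT v φ = φ) (β : ℝ) :
    T v ⁻¹' {x | β ≤ φ x} =ᵐ[μ] ({x | β ≤ φ x} : Set X) := by
  have h1 := coeFn_koopman hT v φ
  rw [h] at h1
  filter_upwards [h1] with x hx
  simp only [Function.comp_apply] at hx
  exact propext (by change β ≤ φ (T v x) ↔ β ≤ φ x; rw [hx])

/-- A set of positive measure invariant under `kℤ^d` has measure at least `k ^ (-d)`. -/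
lemma one_le_pow_mul_measureReal [IsProbabilityMeasure μ] (hT : IsErgodicAction d T μ) {k : ℕ}
    (hk : 0 < k) {C : Set X} (hC : MeasurableSet C)
    (hinv : ∀ v : Fin d → ℤ, T ((k : ℤ) • v) ⁻¹' C =ᵐ[μ] C) (hpos : 0 < μ C) :
    1 ≤ (k : ℝ) ^ d * μ.real C := by
  have hmeas : ∀ v, Measurable (T v) := fun v => (hT.1.2.2 v).measurable
  set E : Set X := ⋃ v : Fin d → Fin k, T (fun i => ((v i : ℕ) : ℤ)) ⁻¹' C with hE
  have hEm : MeasurableSet E := MeasurableSet.iUnion fun v => hmeas _ hC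
  have hle : ∀ w, T w ⁻¹' E ≤ᵐ[μ] E := by
    intro w
    rw [hE, Set.preimage_iUnion]
    have h1 : ∀ v : Fin d → Fin k,
        T w ⁻¹' (T (fun i => ((v i : ℕ) : ℤ)) ⁻¹' C) ≤ᵐ[μ] E := by
      intro v
      have hk' : (0 : ℤ) < k := by exact_mod_cast hk
      let v' : Fin d → Fin k := fun i => ⟨((v i + w i) % k).toNat, by
        have h1 := Int.emod_lt_of_pos ((v i : ℤ) + w i) hk'
        have h2 := Int.emod_nonneg ((v i : ℤ) + w i) hk'.ne'
        omega⟩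
      have hsplit : (fun i => ((v i : ℕ) : ℤ)) + w =
          (k : ℤ) • (fun i => ((v i : ℤ) + w i) / k) + (fun i => ((v' i : ℕ) : ℤ)) := by
        funext i
        have h2 := Int.emod_nonneg ((v i : ℤ) + w i) hk'.ne'
        simp only [Pi.add_apply, Pi.smul_apply, smul_eq_mul, v', Int.toNat_of_nonneg h2]
        exact (Int.mul_ediv_add_emod _ _).symm
      rw [← Set.preimage_comp, ← hT.1.2.1, hsplit, hT.1.2.1, Set.preimage_comp]
      have h3 := (hT.1.2.2 (fun i => ((v' i : ℕ) : ℤ))).quasiMeasurePreserving.preimage_ae_eq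
        (hinv (fun i => ((v i : ℤ) + w i) / k))
      refine h3.le.trans (LE.le.eventuallyLE ?_)
      exact Set.subset_iUnion (fun v : Fin d → Fin k => T (fun i => ((v i : ℕ) : ℤ)) ⁻¹' C) v'
    have h2 : ∀ᵐ x ∂μ, ∀ v : Fin d → Fin k,
        x ∈ T w ⁻¹' (T (fun i => ((v i : ℕ) : ℤ)) ⁻¹' C) → x ∈ E := ae_all_iff.2 h1
    filter_upwards [h2] with x hx hxE
    obtain ⟨v, hv⟩ := Set.mem_iUnion.1 hxE
    exact hx v hv
  have hEinv : ∀ w, μ ((T w ⁻¹' E) ∆ E) = 0 := by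
    intro w
    rw [measure_symmDiff_eq_zero_iff]
    exact ae_eq_of_ae_subset_of_measure_ge (hle w)
      ((hT.1.2.2 w).measure_preimage hEm.nullMeasurableSet).ge
      (hmeas w hEm).nullMeasurableSet (measure_ne_top _ _)
  have hCE : μ C ≤ μ E := by
    refine measure_mono fun x hx => Set.mem_iUnion.2 ⟨fun _ => ⟨0, hk⟩, ?_⟩
    have : (fun _ : Fin d => (((⟨0, hk⟩ : Fin k) : ℕ) : ℤ)) = 0 := by funext i; simp
    rw [this, hT.1.1]
    exact hx
  have hE1 : μ E = 1 := (hT.2 E hEm hEinv).resolve_left (hpos.trans_le hCE).ne'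
  calc (1 : ℝ) = μ.real E := by simp [measureReal_def, hE1]
    _ ≤ ∑ v : Fin d → Fin k, μ.real (T (fun i => ((v i : ℕ) : ℤ)) ⁻¹' C) :=
        measureReal_iUnion_fintype_le _
    _ = ∑ v : Fin d → Fin k, μ.real C := Finset.sum_congr rfl fun v _ =>
        (hT.1.2.2 _).measureReal_preimage hC.nullMeasurableSet
    _ = _ := by simp

/-- An invariant set can be shrunk to an ergodic one without decreasing the density of `A`. -/
lemma exists_ergodic_subset [IsProbabilityMeasure μ] (hT : IsErgodicAction d T μ) {k : ℕ}
    (hk : 0 < k) {A : Set X} {β : ℝ} {C : Set X} (hC : MeasurableSet C)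
    (hinv : ∀ v : Fin d → ℤ, T ((k : ℤ) • v) ⁻¹' C =ᵐ[μ] C) (hpos : 0 < μ C)
    (hβ : β * μ.real C ≤ μ.real (A ∩ C)) :
    ∃ E : Set X, MeasurableSet E ∧ (∀ v : Fin d → ℤ, T ((k : ℤ) • v) ⁻¹' E =ᵐ[μ] E) ∧ 0 < μ E ∧
      SubActionErgodic d k T ((μ E)⁻¹ • μ.restrict E) ∧ β * μ.real E ≤ μ.real (A ∩ E) := by
  obtain ⟨n, hn⟩ : ∃ n : ℕ, (k : ℝ) ^ d * μ.real C ≤ n := exists_nat_ge _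
  induction n generalizing C with
  | zero =>
    have := one_le_pow_mul_measureReal hT hk hC hinv hpos
    norm_num at hn
    linarith
  | succ n ih =>
    by_cases herg : SubActionErgodic d k T ((μ C)⁻¹ • μ.restrict C)
    · exact ⟨C, hC, hinv, hpos, herg, hβ⟩
    simp only [SubActionErgodic, not_forall, not_or] at herg
    obtain ⟨B, hB, hBinv, hB0, hB1⟩ := herg
    have hinv0 : (μ C)⁻¹ ≠ 0 := ENNReal.inv_ne_zero.2 (measure_ne_top μ C)
    have hmeas : ∀ v, Measurable (T v) := fun v => (hT.1.2.2 v).measurable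
    have hBC : ∀ v : Fin d → ℤ, ∀ᵐ x ∂μ, x ∈ C → (T ((k : ℤ) • v) x ∈ B ↔ x ∈ B) := by
      intro v
      have h1 := hBinv v
      rw [Measure.smul_apply, smul_eq_mul, mul_eq_zero, or_iff_right hinv0,
        measure_symmDiff_eq_zero_iff] at h1
      exact (ae_restrict_iff' hC).1 (h1.mono fun x hx => iff_of_eq hx)
    have hpos1 : 0 < μ (C ∩ B) := by
      refine pos_iff_ne_zero.2 fun h => hB0 ?_
      rw [Measure.smul_apply, Measure.restrict_apply hB, Set.inter_comm, h, smul_zero]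
    have hpos2 : 0 < μ (C \ B) := by
      refine pos_iff_ne_zero.2 fun h => hB1 ?_
      have h1 := measure_inter_add_sdiff (μ := μ) C hB
      rw [h, add_zero] at h1
      rw [Measure.smul_apply, Measure.restrict_apply hB, Set.inter_comm, h1, smul_eq_mul,
        ENNReal.inv_mul_cancel hpos.ne' (measure_ne_top _ _)]
    have hinv1 : ∀ v : Fin d → ℤ, T ((k : ℤ) • v) ⁻¹' (C ∩ B) =ᵐ[μ] (C ∩ B : Set X) := by
      intro v
      filter_upwards [hBC v, hinv v] with x h1 h2
      have h2' : T ((k : ℤ) • v) x ∈ C ↔ x ∈ C := iff_of_eq h2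
      refine propext ?_
      change (_ ∈ C ∧ _ ∈ B) ↔ (_ ∈ C ∧ _ ∈ B)
      tauto
    have hinv2 : ∀ v : Fin d → ℤ, T ((k : ℤ) • v) ⁻¹' (C \ B) =ᵐ[μ] (C \ B : Set X) := by
      intro v
      filter_upwards [hBC v, hinv v] with x h1 h2
      have h2' : T ((k : ℤ) • v) x ∈ C ↔ x ∈ C := iff_of_eq h2
      refine propext ?_
      change (_ ∈ C ∧ _ ∉ B) ↔ (_ ∈ C ∧ _ ∉ B)
      tauto
    have hsum : μ.real (C ∩ B) + μ.real (C \ B) = μ.real C := measureReal_inter_add_sdiff hB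
    have hsumA : μ.real (A ∩ (C ∩ B)) + μ.real (A ∩ (C \ B)) = μ.real (A ∩ C) := by
      rw [← Set.inter_assoc, ← Set.inter_sdiff_assoc]
      exact measureReal_inter_add_sdiff hB
    have hl1 := one_le_pow_mul_measureReal hT hk (hC.inter hB) hinv1 hpos1
    have hl2 := one_le_pow_mul_measureReal hT hk (hC.diff hB) hinv2 hpos2
    rw [← hsum] at hn hβ
    push_cast at hn
    rw [mul_add] at hn hβ
    rcases le_or_gt (β * μ.real (C ∩ B)) (μ.real (A ∩ (C ∩ B))) with h | h
    · exact ih (hC.inter hB) hinv1 hpos1 h (by linarith)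
    · exact ih (hC.diff hB) hinv2 hpos2 (by linarith) (by linarith)

end Koopman

section DensityIncrement

/-- If the polynomial translates of `A` miss a proportion `ε` of an invariant set `C`, then `A`
has larger density on some set invariant under a finite index subgroup. -/
lemma exists_density_increment {r d : ℕ} (p : Fin d → MvPolynomial (Fin r) ℤ)
    (hp0 : ∀ i, MvPolynomial.constantCoeff (p i) = 0)
    (hind : LinearIndependent ℚ fun i => (p i).map (Int.castRingHom ℚ))
    {δ ε : ℝ} (hδ : 0 < δ) (hε : 0 < ε) {k : ℕ} (hk : 0 < k) :
    ∃ M : ℕ, 0 < M ∧ ∀ (X : Type) [MeasurableSpace X] (μ : Measure X) [IsProbabilityMeasure μ]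
      (T : (Fin d → ℤ) → X → X), IsErgodicAction d T μ → ∀ A C : Set X, MeasurableSet A →
      MeasurableSet C → (∀ v : Fin d → ℤ, T ((k : ℤ) • v) ⁻¹' C =ᵐ[μ] C) → 0 < μ C →
      ∀ α, δ ≤ α → α * μ.real C ≤ μ.real (A ∩ C) →
      ε * μ.real C ≤
        μ.real (C \ ⋃ n : Fin r → ℤ, T (fun i => MvPolynomial.eval n (p i)) ⁻¹' A) →
      ∃ E, MeasurableSet E ∧ (∀ v : Fin d → ℤ, T (((k * M : ℕ) : ℤ) • v) ⁻¹' E =ᵐ[μ] E) ∧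
        0 < μ E ∧ (α + δ * ε / 2) * μ.real E ≤ μ.real (A ∩ E) := by
  obtain ⟨D, e, a, Q, hQ, hcurve, hgen⟩ := exists_curve p hp0 hind
  have hkd : (0 : ℝ) < (k : ℝ) ^ d := by positivity
  obtain ⟨L, hL, hmean⟩ := exists_hasSmallMeans_polySeq (Fin d → ℤ) D
    (δ * ε / 4 / (k : ℝ) ^ d) (by positivity)
  refine ⟨L * k ^ D * Q, by positivity, fun X _ μ _ T hT A C hA hC hinv hpos α hα hdens hbad => ?_⟩
  have hU := isIsometricRep_koopman hT.1
  set U := koopman hT.1 with hUdef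
  set b : ℕ → Fin d → ℤ := fun j => k ^ (j + 1) • a j with hb
  let Z := fixedVectors U {g | ∃ j < D, g = L • b j}
  have hZ : ∀ w, w ∈ Z ↔ ∀ j < D, U (L • b j) w = w := by
    intro w
    rw [mem_fixedVectors]
    constructor
    · exact fun h j hj => h _ ⟨j, hj, rfl⟩
    · rintro h _ ⟨j, hj, rfl⟩
      exact h j hj
  set f : Lp ℝ 2 μ := indicatorConstLp 2 hA (measure_ne_top μ A) (1 : ℝ) with hf
  set φ : Lp ℝ 2 μ := Z.starProjection f with hφ
  have hφZ : φ ∈ Z := Z.starProjection_apply_mem f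
  have horth : ∀ w ∈ Z, inner ℝ (f - φ) w = 0 := Z.starProjection_inner_eq_zero f
  have hind1 : ∀ {s : Set X} (hs : MeasurableSet s),
      ‖indicatorConstLp 2 hs (measure_ne_top μ s) (1 : ℝ)‖ ≤ 1 := by
    intro s hs
    refine norm_indicatorConstLp_le.trans ?_
    rw [norm_one, one_mul]
    exact Real.rpow_le_one measureReal_nonneg measureReal_le_one (by positivity)
  have hsmall := hmean _ U hU b (f - φ)
    ((norm_sub_starProjection_le Z f).trans (hind1 hA)) fun w hw => horth w ((hZ w).2 hw)
  have hker : ∀ v : Fin d → ℤ, U ((L * k ^ D * Q) • v) φ = φ := fun v =>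
    smul_mem_of_smul_pow_smul_mem hgen (fixer hU φ) ((hZ φ).1 hφZ) v
  have hfixed_inner : ∀ {s : Set X} (hs : MeasurableSet s),
      (∀ j < D, T (L • b j) ⁻¹' s =ᵐ[μ] s) → ∫ x in s, φ x ∂μ = μ.real (A ∩ s) := by
    intro s hs hsinv
    have h1 := horth (indicatorConstLp 2 hs (measure_ne_top μ s) (1 : ℝ))
      ((hZ _).2 fun j hj => koopman_indicatorConstLp_eq_self hT.1 hs (hsinv j hj))
    rw [inner_sub_left, sub_eq_zero, L2.real_inner_indicatorConstLp_one_indicatorConstLp_one,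
      real_inner_comm, L2.inner_indicatorConstLp_one] at h1
    exact h1.symm
  have hinvb : ∀ j, T (L • b j) ⁻¹' C =ᵐ[μ] C := by
    intro j
    have : L • b j = (k : ℤ) • ((L * k ^ j) • a j) := by
      rw [natCast_zsmul, smul_smul, smul_smul]
      congr 1
      ring
    rw [this]
    exact hinv _
  set β := α + δ * ε / 2 with hβ
  set E : Set X := C ∩ {x | β ≤ φ x} with hE
  have hEm : MeasurableSet E :=
    hC.inter (measurableSet_le measurable_const (Lp.stronglyMeasurable φ).measurable)
  have hint : Integrable φ μ := (Lp.memLp φ).integrable one_le_two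
  have hEinv : ∀ v, T v ⁻¹' C =ᵐ[μ] C → U v φ = φ → T v ⁻¹' E =ᵐ[μ] E := fun v h1 h2 => by
    rw [hE, Set.preimage_inter]
    exact h1.inter (preimage_superlevel_ae_eq hT.1 h2 β)
  have hEb : ∀ j < D, T (L • b j) ⁻¹' E =ᵐ[μ] E := fun j hj =>
    hEinv _ (hinvb j) ((hZ φ).1 hφZ j hj)
  by_cases hE0 : 0 < μ E
  · refine ⟨E, hEm, fun v => hEinv _ ?_ ?_, hE0, ?_⟩
    · rw [Nat.cast_mul, mul_smul]
      exact hinv _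
    · rw [mul_comm k, Nat.cast_mul, mul_smul, natCast_zsmul]
      exact hker _
    · rw [← hfixed_inner hEm hEb, mul_comm, ← smul_eq_mul, ← setIntegral_const]
      exact setIntegral_mono_on (integrable_const _).integrableOn hint.integrableOn hEm
        fun x hx => hx.2
  exfalso
  have hlt : ∀ᵐ x ∂μ.restrict C, 0 ≤ β - φ x := by
    rw [ae_restrict_iff' hC]
    have : ∀ᵐ x ∂μ, x ∉ E := measure_eq_zero_iff_ae_notMem.1 (le_antisymm (not_lt.1 hE0) zero_le)
    filter_upwards [this] with x hx hxC
    by_contra h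
    exact hx ⟨hxC, by change β ≤ φ x; linarith⟩
  have hintβ : Integrable (fun x => β - φ x) μ := (integrable_const β).sub hint
  have hintC : ∫ x in C, (β - φ x) ∂μ ≤ δ * ε / 2 * μ.real C := by
    rw [integral_sub (integrable_const _) hint.integrableOn, setIntegral_const,
      hfixed_inner hC fun j _ => hinvb j, smul_eq_mul]
    have : μ.real C * β = α * μ.real C + δ * ε / 2 * μ.real C := by rw [hβ]; ring
    linarith
  set B : Set X := C \ ⋃ n : Fin r → ℤ, T (fun i => MvPolynomial.eval n (p i)) ⁻¹' A with hB
  have hBm : MeasurableSet B :=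
    hC.diff (MeasurableSet.iUnion fun n => (hT.1.2.2 _).measurable hA)
  set oneB : Lp ℝ 2 μ := indicatorConstLp 2 hBm (measure_ne_top μ B) (1 : ℝ) with honeB
  have hzero : ∀ n, inner ℝ oneB (U (polySeq D b n) f) = 0 := by
    intro n
    rw [hUdef, hf, koopman_indicatorConstLp,
      L2.real_inner_indicatorConstLp_one_indicatorConstLp_one]
    have : B ∩ T (polySeq D b n) ⁻¹' A = ∅ := by
      rw [hb, ← polySeq_mul, ← hcurve]
      ext x
      simp only [Set.mem_inter_iff, Set.mem_empty_iff_false, iff_false, not_and]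
      exact fun hx hxA => hx.2 (Set.mem_iUnion.2 ⟨_, hxA⟩)
    rw [this, measureReal_empty]
  have hlower : ∀ n, β * μ.real B - δ * ε / 2 * μ.real C ≤
      inner ℝ oneB (U (polySeq D b n) φ) := by
    intro n
    obtain ⟨u, hu⟩ := exists_polySeq_eq_smul D k n a
    have h1 := hU.inner_eq (-polySeq D b n) oneB φ
    rw [neg_neg] at h1
    rw [← h1, honeB, hUdef, koopman_indicatorConstLp, L2.inner_indicatorConstLp_one]
    set B' := T (-polySeq D b n) ⁻¹' B with hB'
    have hB'C : B' ≤ᵐ[μ] C := by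
      have h2 : B' ⊆ T (-polySeq D b n) ⁻¹' C := Set.preimage_mono Set.sdiff_subset
      refine h2.eventuallyLE.trans ?_
      have h3 : -polySeq D b n = (k : ℤ) • (-u) := by rw [hu, natCast_zsmul, smul_neg]
      rw [h3]
      exact (hinv _).le
    have h4 : ∫ x in B', (β - φ x) ∂μ ≤ ∫ x in C, (β - φ x) ∂μ :=
      setIntegral_mono_set hintβ.integrableOn hlt hB'C
    have h5 : μ.real B' = μ.real B := (hT.1.2.2 _).measureReal_preimage hBm.nullMeasurableSet
    rw [integral_sub (integrable_const _) hint.integrableOn, setIntegral_const, smul_eq_mul,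
      h5] at h4
    linarith
  obtain ⟨N, hN, hN0⟩ := (hsmall.and (eventually_gt_atTop 0)).exists
  have hN0' : (0 : ℝ) < N := by exact_mod_cast hN0
  have hsum : N * (β * μ.real B - δ * ε / 2 * μ.real C) ≤ N * (δ * ε / 4 / (k : ℝ) ^ d) := by
    calc _ = ∑ n ∈ Finset.range N, (β * μ.real B - δ * ε / 2 * μ.real C) := by
          rw [Finset.sum_const, Finset.card_range, nsmul_eq_mul]
      _ ≤ ∑ n ∈ Finset.range N, inner ℝ oneB (U (polySeq D b n) φ) :=
          Finset.sum_le_sum fun n _ => hlower n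
      _ = -inner ℝ oneB (∑ n ∈ Finset.range N, U (polySeq D b n) (f - φ)) := by
          simp only [map_sub, inner_sum, inner_sub_right, hzero, zero_sub, Finset.sum_neg_distrib,
            neg_neg]
      _ ≤ ‖inner ℝ oneB (∑ n ∈ Finset.range N, U (polySeq D b n) (f - φ))‖ := neg_le_abs _
      _ ≤ ‖oneB‖ * ‖∑ n ∈ Finset.range N, U (polySeq D b n) (f - φ)‖ := norm_inner_le_norm _ _
      _ ≤ 1 * (δ * ε / 4 / (k : ℝ) ^ d * N) := by
          gcongr
          exact hind1 hBm
      _ = _ := by ring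
  have hsum' := le_of_mul_le_mul_left hsum hN0'
  have hC1 := one_le_pow_mul_measureReal hT hk hC hinv hpos
  rw [le_div_iff₀ hkd] at hsum'
  have hδε : 0 < δ * ε := mul_pos hδ hε
  have hβB : δ * ε * μ.real C ≤ β * μ.real B := by
    calc _ = δ * (ε * μ.real C) := by ring
      _ ≤ β * μ.real B := by
        have : 0 ≤ ε * μ.real C := by positivity
        refine mul_le_mul (by linarith) hbad this (by linarith)
  have h1 : δ * ε / 2 * 1 ≤ δ * ε / 2 * ((k : ℝ) ^ d * μ.real C) := by gcongr
  have h2 : (δ * ε / 2 * μ.real C) * (k : ℝ) ^ d ≤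
      (β * μ.real B - δ * ε / 2 * μ.real C) * (k : ℝ) ^ d := by
    gcongr
    linarith
  linarith

/-- Iterating the density increment, starting from an ergodic invariant set `C` in which `A` has
density at least `α`. -/
lemma exists_component_of_density {r d : ℕ} (p : Fin d → MvPolynomial (Fin r) ℤ)
    (hp0 : ∀ i, MvPolynomial.constantCoeff (p i) = 0)
    (hind : LinearIndependent ℚ fun i => (p i).map (Int.castRingHom ℚ))
    {δ ε : ℝ} (hδ : 0 < δ) (hε : 0 < ε) (m : ℕ) :
    ∀ k : ℕ, 0 < k → ∃ k₀ : ℕ, 0 < k₀ ∧ ∀ (X : Type) [MeasurableSpace X] (μ : Measure X)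
      [IsProbabilityMeasure μ] (T : (Fin d → ℤ) → X → X), IsErgodicAction d T μ →
      ∀ A C : Set X, MeasurableSet A → MeasurableSet C →
      (∀ v : Fin d → ℤ, T ((k : ℤ) • v) ⁻¹' C =ᵐ[μ] C) → 0 < μ C →
      SubActionErgodic d k T ((μ C)⁻¹ • μ.restrict C) →
      ∀ α, δ ≤ α → 1 - m * (δ * ε / 2) < α → α * μ.real C ≤ μ.real (A ∩ C) →
      ∃ k' : ℕ, 0 < k' ∧ k' ≤ k₀ ∧ ∃ E : Set X, MeasurableSet E ∧
        (∀ v : Fin d → ℤ, T ((k' : ℤ) • v) ⁻¹' E =ᵐ[μ] E) ∧ 0 < μ E ∧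
        SubActionErgodic d k' T ((μ E)⁻¹ • μ.restrict E) ∧ α * μ.real E ≤ μ.real (A ∩ E) ∧
        μ.real (E \ ⋃ n : Fin r → ℤ, T (fun i => MvPolynomial.eval n (p i)) ⁻¹' A) <
          ε * μ.real E := by
  have hδε : 0 < δ * ε := mul_pos hδ hε
  induction m with
  | zero =>
    refine fun k hk => ⟨1, one_pos, fun X _ μ _ T hT A C hA hC hinv hpos herg α hα h1 h2 => ?_⟩
    exfalso
    have h3 : μ.real (A ∩ C) ≤ μ.real C := measureReal_mono Set.inter_subset_right
    have h4 : 0 < μ.real C := ENNReal.toReal_pos hpos.ne' (measure_ne_top _ _)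
    norm_num at h1
    nlinarith
  | succ m ih =>
    intro k hk
    obtain ⟨M, hM, hstep⟩ := exists_density_increment p hp0 hind hδ hε hk
    obtain ⟨k₁, hk₁, hrec⟩ := ih (k * M) (by positivity)
    refine ⟨k + k₁, by positivity, fun X _ μ _ T hT A C hA hC hinv hpos herg α hα h1 h2 => ?_⟩
    rcases lt_or_ge (μ.real
        (C \ ⋃ n : Fin r → ℤ, T (fun i => MvPolynomial.eval n (p i)) ⁻¹' A))
        (ε * μ.real C) with hgood | hbad
    · exact ⟨k, hk, by omega, C, hC, hinv, hpos, herg, h2, hgood⟩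
    obtain ⟨E, hE, hEinv, hEpos, hEdens⟩ := hstep X μ T hT A C hA hC hinv hpos α hα h2 hbad
    obtain ⟨F, hF, hFinv, hFpos, hFerg, hFdens⟩ :=
      exists_ergodic_subset hT (by positivity : 0 < k * M) hE hEinv hEpos hEdens
    obtain ⟨k', hk', hle, R, hR, hRinv, hRpos, hRerg, hRdens, hRgood⟩ :=
      hrec X μ T hT A F hA hF hFinv hFpos hFerg (α + δ * ε / 2) (by linarith)
        (by push_cast at h1; linarith) hFdens
    refine ⟨k', hk', by omega, R, hR, hRinv, hRpos, hRerg, ?_, hRgood⟩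
    have : 0 ≤ δ * ε / 2 * μ.real R := by positivity
    linarith

end DensityIncrement

/-- **Theorem C (Quantitative polynomial expansivity).** Let `P = (P₁, …, P_d) : ℤ^r → ℤ^d`
be an integer polynomial map with zero constant term whose components are linearly
independent over `ℚ`. For all `δ, ε > 0` there is `k₀ = k₀(P, δ, ε)` such that for every
ergodic measure-preserving `ℤ^d`-action `T` on a probability space `(X, μ)` and every
measurable `A` with `μ(A) ≥ δ`, there are a positive `k ≤ k₀` and a `T^k`-ergodic
component `ν` of `μ` with `ν(A) ≥ μ(A)` and `ν(⋃_{n ∈ ℤ^r} (T^{P(n)})⁻¹ A) > 1 - ε`. -/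
theorem quantitative_polynomial_expansivity
    (r d : ℕ) (p : Fin d → MvPolynomial (Fin r) ℤ)
    (hp0 : ∀ i, MvPolynomial.constantCoeff (p i) = 0)
    (hind : LinearIndependent ℚ fun i => (p i).map (Int.castRingHom ℚ))
    (δ ε : ℝ) (hδ : 0 < δ) (hε : 0 < ε) :
    ∃ k₀ : ℕ, 0 < k₀ ∧
      ∀ (X : Type) (_ : MeasurableSpace X) (μ : Measure X) (_ : IsProbabilityMeasure μ)
        (T : (Fin d → ℤ) → X → X), IsErgodicAction d T μ →
        ∀ A : Set X, MeasurableSet A → δ ≤ (μ A).toReal →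
          ∃ k : ℕ, 0 < k ∧ k ≤ k₀ ∧
            ∃ ν : Measure X, IsErgodicComponent d k T μ ν ∧
              (μ A).toReal ≤ (ν A).toReal ∧
              1 - ε < (ν (⋃ n : Fin r → ℤ,
                T (fun i => MvPolynomial.eval n (p i)) ⁻¹' A)).toReal := by
  obtain ⟨m, hm⟩ := exists_nat_gt (1 / (δ * ε / 2))
  have hδε : 0 < δ * ε / 2 := by positivity
  rw [div_lt_iff₀ hδε] at hm
  obtain ⟨k₀, hk₀, h⟩ := exists_component_of_density p hp0 hind hδ hε m 1 one_pos
  refine ⟨k₀, hk₀, fun X _ μ _ T hT A hA hδA => ?_⟩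
  have herg : SubActionErgodic d 1 T ((μ Set.univ)⁻¹ • μ.restrict Set.univ) := by
    intro B hB hBinv
    simp only [measure_univ, inv_one, one_smul, Measure.restrict_univ, Nat.cast_one] at hBinv ⊢
    exact hT.2 B hB hBinv
  obtain ⟨k, hk, hle, E, hE, hEinv, hEpos, hEerg, hdens, hgood⟩ :=
    h X μ T hT A Set.univ hA MeasurableSet.univ (fun v => EventuallyEq.rfl)
      (by simp) herg (μ.real A) hδA (by linarith [hδA.trans' hδ.le, measureReal_def μ A])
      (by simp)
  have hEpos' : 0 < μ.real E := ENNReal.toReal_pos hEpos.ne' (measure_ne_top _ _)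
  have hν : ∀ s, MeasurableSet s →
      (((μ E)⁻¹ • μ.restrict E) s).toReal = (μ.real E)⁻¹ * μ.real (s ∩ E) := by
    intro s hs
    rw [Measure.smul_apply, Measure.restrict_apply hs, smul_eq_mul, ENNReal.toReal_mul,
      ENNReal.toReal_inv]
    rfl
  refine ⟨k, hk, hle, (μ E)⁻¹ • μ.restrict E, ⟨E, hE, hEpos, fun v => ?_, rfl, hEerg⟩, ?_, ?_⟩
  · exact measure_symmDiff_eq_zero_iff.2 (hEinv v)
  · rw [hν A hA, le_inv_mul_iff₀ hEpos', mul_comm]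
    exact hdens
  · have hUm : MeasurableSet (⋃ n : Fin r → ℤ,
        T (fun i => MvPolynomial.eval n (p i)) ⁻¹' A) :=
      MeasurableSet.iUnion fun n => (hT.1.2.2 _).measurable hA
    have hsum := measureReal_inter_add_sdiff (μ := μ) (s := E) hUm
    rw [hν _ hUm, lt_inv_mul_iff₀ hEpos', Set.inter_comm]
    linarith
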